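/- Let w be a vertex of H with deg_H(w) ≤ k-1 and suppose that ē_H(sh_H(w)) = (k-1)·|sh_H(w)|. Then w is the only vertex v of sh_H(w) with deg_H(v) ≤ k-1, and furthermore deg_H(w) = k-1. -/

import Mathlib

/-- The number of edges of `H` incident with at least one vertex of `X`. -/
def eBar {V : Type*} [Fintype V] [DecidableEq V] (H : SimpleGraph V) [DecidableRel H.Adj]
    (X : Finset V) : ℕ :=
  (H.edgeFinset.filter (fun e => ∃ v ∈ X, v ∈ e)).card

/-- A subset `Y ⊆ V(H)` is `w`-closed (with respect to the collection `CH`) if: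
(I) `w ∈ Y`; (II) every `D ∈ CH` satisfies `D ⊆ Y` or `D ∩ Y = ∅`; (III) every vertex
outside `Y` adjacent to a vertex of `Y` has degree at least `k` in `H - Y`; (IV) every
`D ∈ CH` adjacent to a vertex of `Y` satisfies `D ⊆ Y`. -/
def WClosed {V : Type*} [Fintype V] [DecidableEq V] (k : ℕ) (H : SimpleGraph V)
    [DecidableRel H.Adj] (CH : Finset (Finset V)) (w : V) (Y : Finset V) : Prop :=
  w ∈ Y ∧
  (∀ D ∈ CH, D ⊆ Y ∨ D ∩ Y = ∅) ∧
  (∀ v ∉ Y, (∃ y ∈ Y, H.Adj v y) → k ≤ (H.neighborFinset v \ Y).card) ∧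
  (∀ D ∈ CH, (∃ d ∈ D, ∃ y ∈ Y, H.Adj d y) → D ⊆ Y)

theorem eBar_insert_le {V : Type*} [Fintype V] [DecidableEq V] (H : SimpleGraph V)
    [DecidableRel H.Adj] (Y : Finset V) (v : V) :
    eBar H (insert v Y) ≤ eBar H Y + (H.neighborFinset v \ Y).card := by
  unfold eBar
  have h : H.edgeFinset.filter (fun e => ∃ u ∈ insert v Y, u ∈ e) ⊆
      H.edgeFinset.filter (fun e => ∃ u ∈ Y, u ∈ e) ∪
        (H.neighborFinset v \ Y).image (fun u => s(v, u)) := by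
    intro e he
    rw [Finset.mem_filter] at he
    obtain ⟨hE, u, hu, hue⟩ := he
    rw [Finset.mem_union]
    by_cases hY : ∃ u ∈ Y, u ∈ e
    · left
      exact Finset.mem_filter.2 ⟨hE, hY⟩
    · right
      have huv : u = v := by
        rcases Finset.mem_insert.1 hu with h | h
        · exact h
        · exact absurd ⟨u, h, hue⟩ hY
      subst huv
      obtain ⟨x, rfl⟩ := Sym2.mem_iff_exists.1 hue
      rw [SimpleGraph.mem_edgeFinset, SimpleGraph.mem_edgeSet] at hE
      refine Finset.mem_image.2 ⟨x, ?_, rfl⟩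
      rw [Finset.mem_sdiff, SimpleGraph.mem_neighborFinset]
      exact ⟨hE, fun hx => hY ⟨x, hx, Sym2.mem_mk_right _ _⟩⟩
  calc _ ≤ _ := Finset.card_le_card h
    _ ≤ _ := Finset.card_union_le _ _
    _ ≤ _ := Nat.add_le_add_left Finset.card_image_le _

theorem eBar_union_lt {V : Type*} [Fintype V] [DecidableEq V] (H : SimpleGraph V)
    [DecidableRel H.Adj] (Y D : Finset V) (d y : V) (hd : d ∈ D) (hy : y ∈ Y)
    (h : H.Adj d y) : eBar H (Y ∪ D) + 1 ≤ eBar H Y + eBar H D := by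
  unfold eBar
  have h1 : H.edgeFinset.filter (fun e => ∃ u ∈ Y ∪ D, u ∈ e) =
      H.edgeFinset.filter (fun e => ∃ u ∈ Y, u ∈ e) ∪
        H.edgeFinset.filter (fun e => ∃ u ∈ D, u ∈ e) := by
    ext e
    simp only [Finset.mem_filter, Finset.mem_union]
    constructor
    · rintro ⟨hE, u, hu | hu, hue⟩
      · exact Or.inl ⟨hE, u, hu, hue⟩
      · exact Or.inr ⟨hE, u, hu, hue⟩
    · rintro (⟨hE, u, hu, hue⟩ | ⟨hE, u, hu, hue⟩)
      · exact ⟨hE, u, Or.inl hu, hue⟩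
      · exact ⟨hE, u, Or.inr hu, hue⟩
  rw [h1, ← Finset.card_union_add_card_inter]
  apply Nat.add_le_add_left
  apply Finset.card_pos.2
  refine ⟨s(d, y), Finset.mem_inter.2 ⟨Finset.mem_filter.2 ⟨?_, y, hy, ?_⟩,
    Finset.mem_filter.2 ⟨?_, d, hd, ?_⟩⟩⟩ <;> simp [h]

/-- The invariant of the sets arising while building the shadow. -/
def ShInv {V : Type*} [Fintype V] [DecidableEq V] (k : ℕ) (H : SimpleGraph V)
    [DecidableRel H.Adj] (CH : Finset (Finset V)) (w : V) (Sh Y : Finset V) : Prop :=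
  Y ⊆ Sh ∧ w ∈ Y ∧ (∀ D ∈ CH, D ⊆ Y ∨ D ∩ Y = ∅) ∧
  eBar H Y ≤ (k - 1) * Y.card ∧
  (H.degree w < k - 1 → eBar H Y < (k - 1) * Y.card) ∧
  (∀ v ∈ Y, H.degree v ≤ k - 1 → v ≠ w → eBar H Y < (k - 1) * Y.card)

/-- If `ē_H(sh_H(w)) = (k-1)·|sh_H(w)|`, then `w` is the only vertex of the shadow of
degree at most `k-1`, and moreover `deg_H(w) = k-1`. -/
theorem shadow_unique_low_degree_vertex {V : Type*} [Fintype V] [DecidableEq V]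
    (k : ℕ) (hk : 2 ≤ k) (H : SimpleGraph V) [DecidableRel H.Adj]
    (CH : Finset (Finset V))
    (hCHne : ∀ D ∈ CH, D.Nonempty)
    (hCHdisj : ∀ D₁ ∈ CH, ∀ D₂ ∈ CH, D₁ ≠ D₂ → Disjoint D₁ D₂)
    (hCHe : ∀ D ∈ CH, eBar H D ≤ (k - 1) * D.card + 1)
    (hCHdeg : ∀ D ∈ CH, ∀ v ∈ D, k ≤ H.degree v)
    (w : V) (hw : H.degree w ≤ k - 1)
    (Sh : Finset V) (hSh : WClosed k H CH w Sh)
    (hShMin : ∀ Y : Finset V, WClosed k H CH w Y → Sh ⊆ Y)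
    (heq : eBar H Sh = (k - 1) * Sh.card) :
    (∀ v ∈ Sh, H.degree v ≤ k - 1 → v = w) ∧ H.degree w = k - 1 := by
  classical
  obtain ⟨hwS, hS2, hS3, hS4⟩ := hSh
  -- base case
  have hbase : ShInv k H CH w Sh {w} := by
    have h0 : eBar H ({w} : Finset V) ≤ H.degree w := by
      have := eBar_insert_le H ∅ w
      have h1 : eBar H (∅ : Finset V) = 0 := by simp [eBar]
      simpa [h1] using this
    refine ⟨by simpa using hwS, by simp, ?_, ?_, ?_, ?_⟩
    · intro D hD
      right
      rw [Finset.inter_singleton_of_notMem]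
      intro hwD
      have := hCHdeg D hD w hwD
      omega
    · simp only [Finset.card_singleton]; omega
    · simp only [Finset.card_singleton]; omega
    · intro v hv _ hne
      exact absurd (Finset.mem_singleton.1 hv) hne
  obtain ⟨Y, hY, hmax⟩ := Finset.exists_max_image
    (Finset.univ.filter (fun Y => ShInv k H CH w Sh Y)) Finset.card
    ⟨{w}, Finset.mem_filter.2 ⟨Finset.mem_univ _, hbase⟩⟩
  obtain ⟨hYS, hwY, hYD, hYe, hYw, hYv⟩ := (Finset.mem_filter.1 hY).2
  have hmax' : ∀ Z, ShInv k H CH w Sh Z → Z.card ≤ Y.card := fun Z hZ =>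
    hmax Z (Finset.mem_filter.2 ⟨Finset.mem_univ _, hZ⟩)
  have hIV : ∀ D ∈ CH, (∃ d ∈ D, ∃ y ∈ Y, H.Adj d y) → D ⊆ Y := by
    rintro D hD ⟨d, hd, y, hy, hdy⟩
    rcases hYD D hD with h | h
    · exact h
    exfalso
    have hdisj : Disjoint Y D := by
      rw [Finset.disjoint_iff_inter_eq_empty, Finset.inter_comm]; exact h
    have hc : (Y ∪ D).card = Y.card + D.card := Finset.card_union_of_disjoint hdisj
    have hlt := eBar_union_lt H Y D d y hd hy hdy
    have hDe := hCHe D hD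
    have hDpos := (hCHne D hD).card_pos
    have hinv : ShInv k H CH w Sh (Y ∪ D) := by
      refine ⟨Finset.union_subset hYS (hS4 D hD ⟨d, hd, y, hYS hy, hdy⟩),
        Finset.mem_union_left _ hwY, ?_, ?_, ?_, ?_⟩
      · intro D' hD'
        by_cases hDD : D' = D
        · left; rw [hDD]; exact Finset.subset_union_right
        rcases hYD D' hD' with h' | h'
        · left; exact h'.trans Finset.subset_union_left
        · right
          rw [Finset.inter_union_distrib_left, h',
            Finset.disjoint_iff_inter_eq_empty.1 (hCHdisj D' hD' D hD hDD)]
          simp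
      · rw [hc, Nat.mul_add]; omega
      · intro hww
        have := hYw hww
        rw [hc, Nat.mul_add]; omega
      · intro v hv hvk hvw
        rcases Finset.mem_union.1 hv with hv | hv
        · have := hYv v hv hvk hvw
          rw [hc, Nat.mul_add]; omega
        · have := hCHdeg D hD v hv
          omega
    have := hmax' _ hinv
    omega
  have hIII : ∀ v ∉ Y, (∃ y ∈ Y, H.Adj v y) → k ≤ (H.neighborFinset v \ Y).card := by
    rintro v hv ⟨y, hy, hvy⟩
    by_contra hlt
    have hvS : v ∈ Sh := by
      by_contra hvS
      have h1 := hS3 v hvS ⟨y, hYS hy, hvy⟩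
      have h2 : (H.neighborFinset v \ Sh).card ≤ (H.neighborFinset v \ Y).card :=
        Finset.card_le_card (Finset.sdiff_subset_sdiff (Finset.Subset.refl _) hYS)
      omega
    have hnD : ∀ D ∈ CH, v ∉ D := fun D hD hvD =>
      hv (hIV D hD ⟨v, hvD, y, hy, hvy⟩ hvD)
    have hc : (insert v Y).card = Y.card + 1 := Finset.card_insert_of_notMem hv
    have hle := eBar_insert_le H Y v
    have hinv : ShInv k H CH w Sh (insert v Y) := by
      refine ⟨Finset.insert_subset hvS hYS, Finset.mem_insert_of_mem hwY, ?_, ?_, ?_, ?_⟩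
      · intro D hD
        rcases hYD D hD with h | h
        · left; exact h.trans (Finset.subset_insert _ _)
        · right
          rw [Finset.inter_insert_of_notMem (hnD D hD)]; exact h
      · rw [hc, Nat.mul_add]; omega
      · intro hww
        have := hYw hww
        rw [hc, Nat.mul_add]; omega
      · intro u hu huk huw
        rcases Finset.mem_insert.1 hu with rfl | hu
        · have h3 : (H.neighborFinset u \ Y).card < H.degree u := by
            rw [← SimpleGraph.card_neighborFinset_eq_degree]
            apply Finset.card_lt_card
            refine (Finset.ssubset_iff_of_subset Finset.sdiff_subset).2 ⟨y, ?_, ?_⟩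
            · rw [SimpleGraph.mem_neighborFinset]; exact hvy
            · intro hh
              exact (Finset.mem_sdiff.1 hh).2 hy
          rw [hc, Nat.mul_add]; omega
        · have := hYv u hu huk huw
          rw [hc, Nat.mul_add]; omega
    have := hmax' _ hinv
    omega
  have hEq : Y = Sh := Finset.Subset.antisymm hYS (hShMin Y ⟨hwY, hYD, hIII, hIV⟩)
  subst hEq
  refine ⟨fun v hv hvk => ?_, ?_⟩
  · by_contra hne
    have := hYv v hv hvk hne
    omega
  · by_contra hne
    have := hYw (by omega)
    omega
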